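/- Let y_i ∈ C²(B₁) for i = 1,2,3, α > 0, and suppose κ_y(ρ) := ∫_{B_ρ} Σ_i det D²y_i dx satisfies ‖κ_y − πΔ²‖_{L¹(6h, R)} ≤ C h^{1/2} R^{1/2} |log h|^α for all R ∈ [6h, 1−5h]. Then Σ_{i=1}^3 ∫_{B_{1−5h}\setminus B_{5h}} |D²y_i|² dx ≥ 2πΔ²(|log h| − 2α log|log h| − C') for a constant C' depending only on Δ, C, α, for all small enough h. -/

import Mathlib

open MeasureTheory Metric

noncomputable section

abbrev E2 : Type := EuclideanSpace ℝ (Fin 2)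

def e2 (i : Fin 2) : E2 := EuclideanSpace.single i (1 : ℝ)

/-- Entry `(i,j)` of the Hessian matrix of `f` at `x`. -/
noncomputable def hess (f : E2 → ℝ) (x : E2) (i j : Fin 2) : ℝ :=
  fderiv ℝ (fun z => fderiv ℝ f z (e2 i)) x (e2 j)

/-- Squared Frobenius norm of the Hessian of `f` at `x`. -/
noncomputable def hessFrobSq (f : E2 → ℝ) (x : E2) : ℝ :=
  ∑ i, ∑ j, (hess f x i j) ^ 2

/-- Determinant of the Hessian of `f` at `x`. -/
noncomputable def hessDet (f : E2 → ℝ) (x : E2) : ℝ :=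
  hess f x 0 0 * hess f x 1 1 - hess f x 0 1 * hess f x 1 0

/-- `κ_y(ρ) = ∫_{B_ρ} Σ_{i=1}^3 det D²yᵢ dx`. -/
noncomputable def kappa3 (y : Fin 3 → E2 → ℝ) (ρ : ℝ) : ℝ :=
  ∫ x in ball (0 : E2) ρ, ∑ i : Fin 3, hessDet (y i) x

/-- Wirtinger's inequality with a parameter `l < 1`, for functions vanishing at the endpoints of an
interval of length `π`. -/
theorem sq_mul_integral_sq_le_of_eq_zero {u u' : ℝ → ℝ} {a l : ℝ}
    (hu : ∀ t, HasDerivAt u (u' t) t) (hu' : Continuous u') (ha : u a = 0)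
    (hb : u (a + Real.pi) = 0) (hl0 : 0 < l) (hl1 : l < 1) :
    l ^ 2 * ∫ t in a..a + Real.pi, u t ^ 2 ≤ ∫ t in a..a + Real.pi, u' t ^ 2 := by
  have hpi := Real.pi_pos
  have huc : Continuous u := continuous_iff_continuousAt.2 fun t => (hu t).continuousAt
  set w : ℝ → ℝ := fun t => -l * Real.tan (l * (t - (a + Real.pi / 2))) with hw
  have hcos : ∀ t ∈ Set.uIcc a (a + Real.pi), 0 < Real.cos (l * (t - (a + Real.pi / 2))) := by
    intro t ht
    rw [Set.uIcc_of_le (by linarith)] at ht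
    apply Real.cos_pos_of_mem_Ioo
    constructor <;> nlinarith [ht.1, ht.2]
  have hwd : ∀ t ∈ Set.uIcc a (a + Real.pi), HasDerivAt w (-l ^ 2 - w t ^ 2) t := by
    intro t ht
    have h1 : HasDerivAt (fun t : ℝ => l * (t - (a + Real.pi / 2))) l t := by
      simpa using ((hasDerivAt_id t).sub_const (a + Real.pi / 2)).const_mul l
    have h2 := ((Real.hasDerivAt_tan (hcos t ht).ne').comp t h1).const_mul (-l)
    refine h2.congr_deriv ?_
    simp only [hw, Real.tan_eq_sin_div_cos]
    have hsc := Real.sin_sq_add_cos_sq (l * (t - (a + Real.pi / 2)))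
    have hne := (hcos t ht).ne'
    generalize l * (t - (a + Real.pi / 2)) = z at hsc hne ⊢
    field_simp
    linear_combination hsc
  have hwc : ContinuousOn w (Set.uIcc a (a + Real.pi)) := fun t ht =>
    (hwd t ht).continuousAt.continuousWithinAt
  have hFTC : ∫ t in a..a + Real.pi,
      (2 * u t * u' t * w t + u t ^ 2 * (-l ^ 2 - w t ^ 2)) = 0 := by
    rw [intervalIntegral.integral_eq_sub_of_hasDerivAt (f := fun t => u t ^ 2 * w t)]
    · simp [ha, hb]
    · intro t ht
      refine (((hu t).pow 2).mul (hwd t ht)).congr_deriv ?_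
      simp
    · exact ContinuousOn.intervalIntegrable (by fun_prop)
  have hint1 : IntervalIntegrable (fun t => u t ^ 2) volume a (a + Real.pi) :=
    Continuous.intervalIntegrable (by fun_prop) _ _
  have hint2 : IntervalIntegrable (fun t => u' t ^ 2) volume a (a + Real.pi) :=
    Continuous.intervalIntegrable (by fun_prop) _ _
  have hint3 : IntervalIntegrable
      (fun t => 2 * u t * u' t * w t + u t ^ 2 * (-l ^ 2 - w t ^ 2)) volume a (a + Real.pi) :=
    ContinuousOn.intervalIntegrable (by fun_prop)
  have hnn : 0 ≤ ∫ t in a..a + Real.pi, (u' t ^ 2 - l ^ 2 * u t ^ 2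
      - (2 * u t * u' t * w t + u t ^ 2 * (-l ^ 2 - w t ^ 2))) := by
    refine intervalIntegral.integral_nonneg (by linarith) fun t _ => ?_
    nlinarith [sq_nonneg (u' t - u t * w t)]
  rw [intervalIntegral.integral_sub (hint2.sub (hint1.const_mul _)) hint3,
    intervalIntegral.integral_sub hint2 (hint1.const_mul _), hFTC,
    intervalIntegral.integral_const_mul] at hnn
  linarith

theorem integral_sq_le_integral_deriv_sq_of_eq_zero {u u' : ℝ → ℝ} {a : ℝ}
    (hu : ∀ t, HasDerivAt u (u' t) t) (hu' : Continuous u') (ha : u a = 0)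
    (hb : u (a + Real.pi) = 0) :
    ∫ t in a..a + Real.pi, u t ^ 2 ≤ ∫ t in a..a + Real.pi, u' t ^ 2 := by
  have hlim : Filter.Tendsto (fun l : ℝ => l ^ 2 * ∫ t in a..a + Real.pi, u t ^ 2)
      (nhdsWithin 1 (Set.Iio 1)) (nhds (1 ^ 2 * ∫ t in a..a + Real.pi, u t ^ 2)) :=
    ((continuous_id.pow 2).mul continuous_const).continuousAt.mono_left nhdsWithin_le_nhds
  rw [one_pow, one_mul] at hlim
  refine le_of_tendsto hlim ?_
  filter_upwards [Ioo_mem_nhdsLT (zero_lt_one (α := ℝ))] with l hl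
  exact sq_mul_integral_sq_le_of_eq_zero hu hu' ha hb hl.1 hl.2

theorem exists_const_integral_sub_sq_le {x x' : ℝ → ℝ}
    (hx : ∀ t, HasDerivAt x (x' t) t) (hx' : Continuous x')
    (hper : Function.Periodic x (2 * Real.pi)) :
    ∃ c, ∫ t in -Real.pi..Real.pi, (x t - c) ^ 2 ≤ ∫ t in -Real.pi..Real.pi, x' t ^ 2 := by
  have hpi := Real.pi_pos
  have hxc : Continuous x := continuous_iff_continuousAt.2 fun t => (hx t).continuousAt
  have hper' : Function.Periodic x' (2 * Real.pi) := by
    intro t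
    have h1 : HasDerivAt (fun s => x (s + 2 * Real.pi)) (x' (t + 2 * Real.pi)) t :=
      (hx (t + 2 * Real.pi)).comp_add_const t (2 * Real.pi)
    rw [show (fun s => x (s + 2 * Real.pi)) = x from funext hper] at h1
    exact h1.unique (hx t)
  obtain ⟨a, ha⟩ : ∃ a, x (a + Real.pi) = x a := by
    have h2 : x (Real.pi + Real.pi) = x 0 := by
      rw [← hper 0]; congr 1; ring
    have hg : Continuous fun t => x (t + Real.pi) - x t := by fun_prop
    have h0 : (0 : ℝ) ∈ Set.uIcc (x (0 + Real.pi) - x 0) (x (Real.pi + Real.pi) - x Real.pi) := by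
      rw [h2, zero_add, Set.mem_uIcc]
      rcases le_total (x 0) (x Real.pi) with h | h
      · right; constructor <;> linarith
      · left; constructor <;> linarith
    obtain ⟨a, _, ha⟩ := intermediate_value_uIcc (f := fun t => x (t + Real.pi) - x t)
      (a := 0) (b := Real.pi) hg.continuousOn h0
    exact ⟨a, sub_eq_zero.1 ha⟩
  refine ⟨x a, ?_⟩
  have hshift : ∀ f : ℝ → ℝ, Continuous f → Function.Periodic f (2 * Real.pi) →
      ∫ t in -Real.pi..Real.pi, f t =
        (∫ t in a..a + Real.pi, f t) + ∫ t in a + Real.pi..a + Real.pi + Real.pi, f t := by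
    intro f hf hfp
    rw [intervalIntegral.integral_add_adjacent_intervals (hf.intervalIntegrable _ _)
      (hf.intervalIntegrable _ _)]
    have := hfp.intervalIntegral_add_eq (-Real.pi) a
    rwa [show -Real.pi + 2 * Real.pi = Real.pi by ring,
      show a + 2 * Real.pi = a + Real.pi + Real.pi by ring] at this
  have hd : ∀ t, HasDerivAt (fun t => x t - x a) (x' t) t := fun t => (hx t).sub_const _
  rw [hshift (fun t => (x t - x a) ^ 2) (by fun_prop) (fun t => by simp only [hper t]),
    hshift (fun t => x' t ^ 2) (by fun_prop) (fun t => by simp only [hper' t])]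
  refine add_le_add
    (integral_sq_le_integral_deriv_sq_of_eq_zero hd hx' (by simp) (by simp [ha]))
    (integral_sq_le_integral_deriv_sq_of_eq_zero hd hx' (by simp [ha]) ?_)
  rw [show a + Real.pi + Real.pi = a + 2 * Real.pi by ring, hper a, sub_self]

/-- The isoperimetric inequality for closed `C¹` curves. -/
theorem integral_mul_deriv_le_of_periodic {x x' y y' : ℝ → ℝ}
    (hx : ∀ t, HasDerivAt x (x' t) t) (hx' : Continuous x')
    (hxp : Function.Periodic x (2 * Real.pi))
    (hy : ∀ t, HasDerivAt y (y' t) t) (hy' : Continuous y')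
    (hyp : Function.Periodic y (2 * Real.pi)) :
    2 * ∫ t in -Real.pi..Real.pi, x t * y' t ≤
      ∫ t in -Real.pi..Real.pi, (x' t ^ 2 + y' t ^ 2) := by
  have hpi := Real.pi_pos
  have hxc : Continuous x := continuous_iff_continuousAt.2 fun t => (hx t).continuousAt
  obtain ⟨c, hc⟩ := exists_const_integral_sub_sq_le hx hx' hxp
  have hi : ∀ f : ℝ → ℝ, Continuous f → IntervalIntegrable f volume (-Real.pi) Real.pi :=
    fun f hf => hf.intervalIntegrable _ _
  have hy0 : ∫ t in -Real.pi..Real.pi, y' t = 0 := by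
    rw [intervalIntegral.integral_eq_sub_of_hasDerivAt (fun t _ => hy t) (hi _ hy'),
      sub_eq_zero, ← hyp (-Real.pi)]
    congr 1; ring
  have h1 : ∫ t in -Real.pi..Real.pi, 2 * ((x t - c) * y' t) =
      2 * ∫ t in -Real.pi..Real.pi, x t * y' t := by
    rw [intervalIntegral.integral_const_mul]
    simp_rw [sub_mul]
    rw [intervalIntegral.integral_sub (hi _ (by fun_prop)) (hi _ (by fun_prop)),
      intervalIntegral.integral_const_mul, hy0]
    ring
  have h2 : ∫ t in -Real.pi..Real.pi, 2 * ((x t - c) * y' t) ≤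
      ∫ t in -Real.pi..Real.pi, ((x t - c) ^ 2 + y' t ^ 2) := by
    refine intervalIntegral.integral_mono_on (by linarith) (hi _ (by fun_prop))
      (hi _ (by fun_prop)) fun t _ => ?_
    nlinarith [sq_nonneg (x t - c - y' t)]
  rw [intervalIntegral.integral_add (hi _ (by fun_prop)) (hi _ (by fun_prop))] at h2 ⊢
  linarith

theorem continuousOn_intervalIntegral_of_continuousOn_prod {X : Type*} [TopologicalSpace X]
    [FirstCountableTopology X] {s : Set X} {f : X → ℝ → ℝ}
    (hf : ContinuousOn (Function.uncurry f) (s ×ˢ Set.univ)) (a b : ℝ) :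
    ContinuousOn (fun x => ∫ t in a..b, f x t) s := by
  rw [continuousOn_iff_continuous_domRestrict]
  refine intervalIntegral.continuous_parametric_intervalIntegral_of_continuous'
    (f := fun (x : s) t => f x t) ?_ a b
  exact hf.comp_continuous (f := fun p : s × ℝ => ((p.1 : X), p.2)) (by fun_prop)
    (fun p => ⟨p.1.2, trivial⟩)

theorem norm_slope_le_of_norm_deriv_le {g g' : ℝ → ℝ} {a b r s M : ℝ}
    (hg : ∀ t ∈ Set.Icc a b, HasDerivAt g (g' t) t) (hM : ∀ t ∈ Set.Icc a b, ‖g' t‖ ≤ M)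
    (hr : r ∈ Set.Icc a b) (hs : s ∈ Set.Icc a b) : ‖slope g r s‖ ≤ M := by
  have hM0 : 0 ≤ M := (norm_nonneg _).trans (hM r hr)
  have h := (convex_Icc a b).norm_image_sub_le_of_norm_hasDerivWithin_le
    (fun t ht => (hg t ht).hasDerivWithinAt) hM hr hs
  rw [slope_def_field, norm_div]
  exact div_le_of_le_mul₀ (norm_nonneg _) hM0 h

/-- Derivative in `r` of the area enclosed by the closed curve `θ ↦ (U r θ, V r θ)`; no second
derivatives are needed. -/
theorem hasDerivAt_integral_mul_deriv {U Ur Ut V Vr Vt : ℝ → ℝ → ℝ}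
    (hUr : ∀ s ∈ Set.Ioo (-1 : ℝ) 1, ∀ t, HasDerivAt (fun s => U s t) (Ur s t) s)
    (hUt : ∀ s ∈ Set.Ioo (-1 : ℝ) 1, ∀ t, HasDerivAt (U s) (Ut s t) t)
    (hVr : ∀ s ∈ Set.Ioo (-1 : ℝ) 1, ∀ t, HasDerivAt (fun s => V s t) (Vr s t) s)
    (hVt : ∀ s ∈ Set.Ioo (-1 : ℝ) 1, ∀ t, HasDerivAt (V s) (Vt s t) t)
    (cUr : ContinuousOn (Function.uncurry Ur) (Set.Ioo (-1 : ℝ) 1 ×ˢ Set.univ))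
    (cUt : ContinuousOn (Function.uncurry Ut) (Set.Ioo (-1 : ℝ) 1 ×ˢ Set.univ))
    (cVr : ContinuousOn (Function.uncurry Vr) (Set.Ioo (-1 : ℝ) 1 ×ˢ Set.univ))
    (cVt : ContinuousOn (Function.uncurry Vt) (Set.Ioo (-1 : ℝ) 1 ×ˢ Set.univ))
    {a b : ℝ} (hab : a ≤ b) (hU : ∀ s, U s a = U s b) (hV : ∀ s, V s a = V s b)
    {r : ℝ} (hr : r ∈ Set.Ioo (-1 : ℝ) 1) :
    HasDerivAt (fun s => ∫ t in a..b, U s t * Vt s t)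
      (∫ t in a..b, (Ur r t * Vt r t - Ut r t * Vr r t)) r := by
  obtain ⟨δ, hδ, hδs⟩ : ∃ δ > 0, Set.Icc (r - δ) (r + δ) ⊆ Set.Ioo (-1 : ℝ) 1 := by
    obtain ⟨ε, hε, h⟩ := Metric.nhds_basis_closedBall.mem_iff.1 (isOpen_Ioo.mem_nhds hr)
    exact ⟨ε, hε, by rwa [← Real.closedBall_eq_Icc]⟩
  have hrδ : r ∈ Set.Icc (r - δ) (r + δ) := ⟨by linarith, by linarith⟩
  have hbd : ∀ W : ℝ → ℝ → ℝ,
      ContinuousOn (Function.uncurry W) (Set.Ioo (-1 : ℝ) 1 ×ˢ Set.univ) →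
      ∃ M, ∀ s ∈ Set.Icc (r - δ) (r + δ), ∀ t ∈ Set.Icc a b, ‖W s t‖ ≤ M := by
    intro W hW
    obtain ⟨M, hM⟩ := (isCompact_Icc.prod isCompact_Icc).exists_bound_of_continuousOn
      (hW.mono (Set.prod_mono hδs (Set.subset_univ (Set.Icc a b))))
    exact ⟨M, fun s hs t ht => hM (s, t) ⟨hs, ht⟩⟩
  have hsec : ∀ W : ℝ → ℝ → ℝ,
      ContinuousOn (Function.uncurry W) (Set.Ioo (-1 : ℝ) 1 ×ˢ Set.univ) →
      ∀ s ∈ Set.Ioo (-1 : ℝ) 1, Continuous (W s) := by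
    intro W hW s hs
    exact hW.comp_continuous (f := fun t => (s, t)) (by fun_prop) (fun t => ⟨hs, trivial⟩)
  have hsecr : ∀ W : ℝ → ℝ → ℝ,
      ContinuousOn (Function.uncurry W) (Set.Ioo (-1 : ℝ) 1 ×ˢ Set.univ) →
      ∀ t, ContinuousAt (fun s => W s t) r := by
    intro W hW t
    have hmaps : Set.MapsTo (fun s : ℝ => (s, t)) (Set.Ioo (-1 : ℝ) 1)
        (Set.Ioo (-1 : ℝ) 1 ×ˢ Set.univ) := fun s hs => ⟨hs, trivial⟩
    exact (hW.comp (by fun_prop) hmaps).continuousAt (isOpen_Ioo.mem_nhds hr)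
  have cU : ∀ s ∈ Set.Ioo (-1 : ℝ) 1, Continuous (U s) := fun s hs =>
    continuous_iff_continuousAt.2 fun t => (hUt s hs t).continuousAt
  have cV : ∀ s ∈ Set.Ioo (-1 : ℝ) 1, Continuous (V s) := fun s hs =>
    continuous_iff_continuousAt.2 fun t => (hVt s hs t).continuousAt
  obtain ⟨M₁, hM₁⟩ := hbd Ur cUr
  obtain ⟨M₂, hM₂⟩ := hbd Ut cUt
  obtain ⟨M₃, hM₃⟩ := hbd Vr cVr
  obtain ⟨M₄, hM₄⟩ := hbd Vt cVt
  have hnhds : ∀ᶠ s in nhdsWithin r {r}ᶜ, s ∈ Set.Icc (r - δ) (r + δ) :=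
    nhdsWithin_le_nhds (Icc_mem_nhds (by linarith) (by linarith))
  have hslope : ∀ s ∈ Set.Ioo (-1 : ℝ) 1,
      slope (fun s => ∫ t in a..b, U s t * Vt s t) r s =
        ∫ t in a..b, (slope (fun s => U s t) r s * Vt s t
          - Ut r t * slope (fun s => V s t) r s) := by
    intro s hs
    have c1 := cU s hs
    have c2 := cV s hs
    have c3 := cU r hr
    have c4 := cV r hr
    have c5 := hsec Vt cVt s hs
    have c6 := hsec Vt cVt r hr
    have c7 := hsec Ut cUt r hr
    have hparts : ∫ t in a..b, U r t * (Vt s t - Vt r t) =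
        - ∫ t in a..b, Ut r t * (V s t - V r t) := by
      rw [intervalIntegral.integral_mul_deriv_eq_deriv_mul
        (fun t _ => hUt r hr t) (fun t _ => (hVt s hs t).sub (hVt r hr t))
        (c7.intervalIntegrable _ _) ((c5.sub c6).intervalIntegrable _ _)]
      simp [hU, hV]
    have hi : ∀ f : ℝ → ℝ, Continuous f → IntervalIntegrable f volume a b :=
      fun f hf => hf.intervalIntegrable _ _
    have hsum : (∫ t in a..b, U s t * Vt s t) - ∫ t in a..b, U r t * Vt r t =
        ∫ t in a..b, ((U s t - U r t) * Vt s t - Ut r t * (V s t - V r t)) := by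
      rw [intervalIntegral.integral_sub (hi _ (by fun_prop)) (hi _ (by fun_prop)),
        sub_eq_add_neg (∫ t in a..b, (U s t - U r t) * Vt s t), ← hparts,
        ← intervalIntegral.integral_sub (hi _ (by fun_prop)) (hi _ (by fun_prop)),
        ← intervalIntegral.integral_add (hi _ (by fun_prop)) (hi _ (by fun_prop))]
      refine intervalIntegral.integral_congr fun t _ => ?_
      ring
    rw [slope_def_field, hsum, ← intervalIntegral.integral_div]
    refine intervalIntegral.integral_congr fun t _ => ?_
    simp only [slope_def_field]
    ring
  rw [hasDerivAt_iff_tendsto_slope]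
  refine Filter.Tendsto.congr' (f₁ := fun s => ∫ t in a..b, (slope (fun s => U s t) r s * Vt s t
      - Ut r t * slope (fun s => V s t) r s)) ?_ ?_
  · filter_upwards [hnhds] with s hs
    exact (hslope s (hδs hs)).symm
  refine intervalIntegral.tendsto_integral_filter_of_dominated_convergence
    (fun _ => M₁ * M₄ + M₂ * M₃) ?_ ?_ intervalIntegrable_const ?_
  · filter_upwards [hnhds] with s hs
    have c1 := cU s (hδs hs)
    have c2 := cV s (hδs hs)
    have c3 := cU r hr
    have c4 := cV r hr
    have c5 := hsec Vt cVt s (hδs hs)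
    have c7 := hsec Ut cUt r hr
    simp only [slope_def_field]
    exact Continuous.aestronglyMeasurable (by fun_prop)
  · filter_upwards [hnhds] with s hs
    refine Filter.Eventually.of_forall fun t ht => ?_
    rw [Set.uIoc_of_le hab] at ht
    have ht' := Set.Ioc_subset_Icc_self ht
    have h1 : ‖slope (fun s => U s t) r s‖ ≤ M₁ :=
      norm_slope_le_of_norm_deriv_le (fun q hq => hUr q (hδs hq) t) (fun q hq => hM₁ q hq t ht')
        hrδ hs
    have h2 : ‖slope (fun s => V s t) r s‖ ≤ M₃ :=
      norm_slope_le_of_norm_deriv_le (fun q hq => hVr q (hδs hq) t) (fun q hq => hM₃ q hq t ht')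
        hrδ hs
    refine (norm_sub_le _ _).trans ?_
    rw [norm_mul, norm_mul]
    exact add_le_add
      (mul_le_mul h1 (hM₄ s hs t ht') (norm_nonneg _) ((norm_nonneg _).trans h1))
      (mul_le_mul (hM₂ r hrδ t ht') h2 (norm_nonneg _)
        ((norm_nonneg _).trans (hM₂ r hrδ t ht')))
  · refine Filter.Eventually.of_forall fun t _ => ?_
    refine Filter.Tendsto.sub (Filter.Tendsto.mul ?_ ?_) (Filter.Tendsto.mul tendsto_const_nhds ?_)
    · exact hasDerivAt_iff_tendsto_slope.1 (hUr r hr t)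
    · exact (hsecr Vt cVt t).tendsto.mono_left nhdsWithin_le_nhds
    · exact hasDerivAt_iff_tendsto_slope.1 (hVr r hr t)

/-- The point of the plane with polar coordinates `(r, t)`. -/
def polarPoint (r t : ℝ) : E2 := !₂[r * Real.cos t, r * Real.sin t]

theorem norm_polarPoint (r t : ℝ) : ‖polarPoint r t‖ = |r| := by
  rw [polarPoint, EuclideanSpace.norm_eq, Fin.sum_univ_two, ← Real.sqrt_sq_eq_abs]
  congr 1
  simp only [Real.norm_eq_abs, sq_abs, Matrix.cons_val_zero, Matrix.cons_val_one]
  linear_combination r ^ 2 * Real.sin_sq_add_cos_sq t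

theorem polarPoint_mem_ball {r t R : ℝ} : polarPoint r t ∈ ball (0 : E2) R ↔ |r| < R := by
  rw [mem_ball_zero_iff, norm_polarPoint]

theorem polarPoint_eq (r t : ℝ) :
    polarPoint r t = (r * Real.cos t) • e2 0 + (r * Real.sin t) • e2 1 := by
  ext i
  fin_cases i <;> simp [polarPoint, e2]

theorem continuous_polarPoint : Continuous fun p : ℝ × ℝ => polarPoint p.1 p.2 := by
  simp only [polarPoint_eq]
  fun_prop

theorem polarPoint_periodic (r : ℝ) : Function.Periodic (polarPoint r) (2 * Real.pi) := by
  intro t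
  simp [polarPoint]

theorem continuousOn_comp_polarPoint {f : E2 → ℝ} (hf : ContinuousOn f (ball 0 1)) :
    ContinuousOn (fun p : ℝ × ℝ => f (polarPoint p.1 p.2))
      (Set.Ioo (-1 : ℝ) 1 ×ˢ Set.univ) :=
  hf.comp continuous_polarPoint.continuousOn fun _ hp =>
    polarPoint_mem_ball.2 (abs_lt.2 hp.1)

theorem continuousOn_integral_polarPoint {f : E2 → ℝ} (hf : ContinuousOn f (ball 0 1)) :
    ContinuousOn (fun r => ∫ t in -Real.pi..Real.pi, r * f (polarPoint r t))
      (Set.Ioo (-1 : ℝ) 1) :=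
  continuousOn_intervalIntegral_of_continuousOn_prod (f := fun r t => r * f (polarPoint r t))
    (continuousOn_fst.mul (continuousOn_comp_polarPoint hf)) _ _

theorem setIntegral_annulus_eq_polar {f : E2 → ℝ} (hf : ContinuousOn f (ball 0 1)) {a b : ℝ}
    (ha : 0 ≤ a) (hab : a ≤ b) (hb : b < 1) :
    ∫ x in ball (0 : E2) b \ ball (0 : E2) a, f x =
      ∫ r in a..b, ∫ t in -Real.pi..Real.pi, r * f (polarPoint r t) := by
  have hpi := Real.pi_pos
  set S : Set E2 := ball (0 : E2) b \ ball (0 : E2) a with hS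
  have hSm : MeasurableSet S := measurableSet_ball.diff measurableSet_ball
  set e : E2 ≃ᵐ ℝ × ℝ :=
    (MeasurableEquiv.toLp 2 (Fin 2 → ℝ)).symm.trans MeasurableEquiv.finTwoArrow with he
  have hmp : MeasurePreserving e :=
    (volume_preserving_finTwoArrow ℝ).comp
      (EuclideanSpace.volume_preserving_symm_measurableEquiv_toLp (Fin 2))
  have hpt : ∀ p : ℝ × ℝ, e.symm (polarCoord.symm p) = polarPoint p.1 p.2 := by
    intro p
    apply e.injective
    rw [e.apply_symm_apply]
    rfl
  have hset : polarCoord.target ∩ (Set.Ico a b ×ˢ Set.univ) =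
      (Set.Ioi 0 ∩ Set.Ico a b) ×ˢ Set.Ioo (-Real.pi) Real.pi := by
    rw [polarCoord_target, Set.prod_inter_prod, Set.inter_univ]
  have hcont : ContinuousOn (fun p : ℝ × ℝ => p.1 * f (polarPoint p.1 p.2))
      (Set.Ioo (-1 : ℝ) 1 ×ˢ Set.univ) :=
    continuousOn_fst.mul (continuousOn_comp_polarPoint hf)
  have hint : IntegrableOn (fun p : ℝ × ℝ => p.1 * f (polarPoint p.1 p.2))
      ((Set.Ioi 0 ∩ Set.Ico a b) ×ˢ Set.Ioo (-Real.pi) Real.pi) := by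
    refine ((hcont.mono ?_).integrableOn_compact
      ((isCompact_Icc (a := a) (b := b)).prod (isCompact_Icc (a := -Real.pi) (b := Real.pi)))).mono_set
        (Set.prod_mono (Set.inter_subset_right.trans Set.Ico_subset_Icc_self)
          Set.Ioo_subset_Icc_self)
    rintro p ⟨hp, -⟩
    exact ⟨⟨by linarith [hp.1], by linarith [hp.2]⟩, trivial⟩
  calc ∫ x in S, f x = ∫ x, S.indicator f x := (integral_indicator hSm).symm
    _ = ∫ p, S.indicator f (e.symm p) := (hmp.symm.integral_comp' (S.indicator f)).symm
    _ = ∫ p in polarCoord.target, p.1 • S.indicator f (e.symm (polarCoord.symm p)) :=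
      (integral_comp_polarCoord_symm _).symm
    _ = ∫ p in polarCoord.target, (Set.Ico a b ×ˢ Set.univ).indicator
          (fun p : ℝ × ℝ => p.1 * f (polarPoint p.1 p.2)) p := by
      refine setIntegral_congr_fun polarCoord.open_target.measurableSet fun p hp => ?_
      have hp0 : 0 < p.1 := hp.1
      have hiff : polarPoint p.1 p.2 ∈ S ↔ p ∈ Set.Ico a b ×ˢ (Set.univ : Set ℝ) := by
        rw [hS, Set.mem_sdiff, polarPoint_mem_ball, polarPoint_mem_ball, abs_of_pos hp0]
        simp [Set.mem_prod, and_comm]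
      simp only [hpt]
      by_cases h : polarPoint p.1 p.2 ∈ S
      · rw [Set.indicator_of_mem h, Set.indicator_of_mem (hiff.1 h), smul_eq_mul]
      · rw [Set.indicator_of_notMem h, Set.indicator_of_notMem (fun h' => h (hiff.2 h')),
          smul_zero]
    _ = ∫ r in Set.Ioi 0 ∩ Set.Ico a b, ∫ t in Set.Ioo (-Real.pi) Real.pi,
          r * f (polarPoint r t) := by
      rw [setIntegral_indicator (measurableSet_Ico.prod MeasurableSet.univ), hset]
      exact setIntegral_prod _ hint
    _ = ∫ r in a..b, ∫ t in -Real.pi..Real.pi, r * f (polarPoint r t) := by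
      have hae : (Set.Ioi 0 ∩ Set.Ico a b : Set ℝ) =ᵐ[volume] Set.Ioc a b := by
        have h := (Ioi_ae_eq_Ici (μ := volume) (a := (0 : ℝ))).inter
          (Ico_ae_eq_Ioc (μ := volume) (a := a) (b := b))
        have hsub : Set.Ioc a b ⊆ Set.Ici 0 := fun x hx => ha.trans hx.1.le
        rwa [Set.inter_eq_right.2 hsub] at h
      rw [setIntegral_congr_set hae, intervalIntegral.integral_of_le hab]
      refine setIntegral_congr_fun measurableSet_Ioc fun r _ => ?_
      rw [intervalIntegral.integral_of_le (by linarith), integral_Ioc_eq_integral_Ioo]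

/-- The radial derivative of `u` at the point with polar coordinates `(r, t)`. -/
def polarDerivR (u : E2 → ℝ) (r t : ℝ) : ℝ :=
  fderiv ℝ u (polarPoint r t) (e2 0) * Real.cos t + fderiv ℝ u (polarPoint r t) (e2 1) * Real.sin t

/-- The angular derivative of `u` at the point with polar coordinates `(r, t)`. -/
def polarDerivT (u : E2 → ℝ) (r t : ℝ) : ℝ :=
  r * (fderiv ℝ u (polarPoint r t) (e2 1) * Real.cos t
    - fderiv ℝ u (polarPoint r t) (e2 0) * Real.sin t)

/-- The Jacobian determinant of the planar map `(u, v)`. -/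
def jacobian (u v : E2 → ℝ) (x : E2) : ℝ :=
  fderiv ℝ u x (e2 0) * fderiv ℝ v x (e2 1) - fderiv ℝ u x (e2 1) * fderiv ℝ v x (e2 0)

theorem continuousOn_fderiv_apply {u : E2 → ℝ} (hu : ContDiffOn ℝ 1 u (ball 0 1)) (w : E2) :
    ContinuousOn (fun x => fderiv ℝ u x w) (ball 0 1) :=
  (hu.continuousOn_fderiv_of_isOpen isOpen_ball le_rfl).clm_apply continuousOn_const

theorem continuousOn_jacobian {u v : E2 → ℝ} (hu : ContDiffOn ℝ 1 u (ball 0 1))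
    (hv : ContDiffOn ℝ 1 v (ball 0 1)) : ContinuousOn (jacobian u v) (ball 0 1) :=
  ((continuousOn_fderiv_apply hu _).mul (continuousOn_fderiv_apply hv _)).sub
    ((continuousOn_fderiv_apply hu _).mul (continuousOn_fderiv_apply hv _))

theorem hasFDerivAt_polarPoint {u : E2 → ℝ} (hu : ContDiffOn ℝ 1 u (ball 0 1)) {r : ℝ}
    (hr : r ∈ Set.Ioo (-1 : ℝ) 1) (t : ℝ) :
    HasFDerivAt u (fderiv ℝ u (polarPoint r t)) (polarPoint r t) :=
  ((hu.differentiableOn one_ne_zero).differentiableAt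
    (isOpen_ball.mem_nhds (polarPoint_mem_ball.2 (abs_lt.2 hr)))).hasFDerivAt

theorem hasDerivAt_polarDerivR {u : E2 → ℝ} (hu : ContDiffOn ℝ 1 u (ball 0 1)) {r : ℝ}
    (hr : r ∈ Set.Ioo (-1 : ℝ) 1) (t : ℝ) :
    HasDerivAt (fun s => u (polarPoint s t)) (polarDerivR u r t) r := by
  have hP : HasDerivAt (fun s => polarPoint s t)
      (Real.cos t • e2 0 + Real.sin t • e2 1) r := by
    simp only [polarPoint_eq]
    refine HasDerivAt.add (HasDerivAt.smul_const ?_ _) (HasDerivAt.smul_const ?_ _)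
    · simpa using (hasDerivAt_id r).mul_const (Real.cos t)
    · simpa using (hasDerivAt_id r).mul_const (Real.sin t)
  refine ((hasFDerivAt_polarPoint hu hr t).comp_hasDerivAt r hP).congr_deriv ?_
  simp only [map_add, map_smul, smul_eq_mul, polarDerivR]
  ring

theorem hasDerivAt_polarDerivT {u : E2 → ℝ} (hu : ContDiffOn ℝ 1 u (ball 0 1)) {r : ℝ}
    (hr : r ∈ Set.Ioo (-1 : ℝ) 1) (t : ℝ) :
    HasDerivAt (fun t => u (polarPoint r t)) (polarDerivT u r t) t := by
  have hP : HasDerivAt (fun t => polarPoint r t)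
      ((r * -Real.sin t) • e2 0 + (r * Real.cos t) • e2 1) t := by
    simp only [polarPoint_eq]
    exact (((Real.hasDerivAt_cos t).const_mul r).smul_const _).add
      (((Real.hasDerivAt_sin t).const_mul r).smul_const _)
  refine ((hasFDerivAt_polarPoint hu hr t).comp_hasDerivAt t hP).congr_deriv ?_
  simp only [map_add, map_smul, smul_eq_mul, polarDerivT]
  ring

theorem continuousOn_polarDerivR {u : E2 → ℝ} (hu : ContDiffOn ℝ 1 u (ball 0 1)) :
    ContinuousOn (Function.uncurry (polarDerivR u)) (Set.Ioo (-1 : ℝ) 1 ×ˢ Set.univ) := by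
  have h0 := continuousOn_comp_polarPoint (continuousOn_fderiv_apply hu (e2 0))
  have h1 := continuousOn_comp_polarPoint (continuousOn_fderiv_apply hu (e2 1))
  exact (h0.mul (by fun_prop)).add (h1.mul (by fun_prop))

theorem continuousOn_polarDerivT {u : E2 → ℝ} (hu : ContDiffOn ℝ 1 u (ball 0 1)) :
    ContinuousOn (Function.uncurry (polarDerivT u)) (Set.Ioo (-1 : ℝ) 1 ×ˢ Set.univ) := by
  have h0 := continuousOn_comp_polarPoint (continuousOn_fderiv_apply hu (e2 0))
  have h1 := continuousOn_comp_polarPoint (continuousOn_fderiv_apply hu (e2 1))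
  exact continuousOn_fst.mul ((h1.mul (by fun_prop)).sub (h0.mul (by fun_prop)))

/-- The signed area enclosed by the image of the circle of radius `r` under `(u, v)`. -/
def circleArea (u v : E2 → ℝ) (r : ℝ) : ℝ :=
  ∫ t in -Real.pi..Real.pi, u (polarPoint r t) * polarDerivT v r t

theorem hasDerivAt_circleArea {u v : E2 → ℝ} (hu : ContDiffOn ℝ 1 u (ball 0 1))
    (hv : ContDiffOn ℝ 1 v (ball 0 1)) {r : ℝ} (hr : r ∈ Set.Ioo (-1 : ℝ) 1) :
    HasDerivAt (circleArea u v)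
      (∫ t in -Real.pi..Real.pi, r * jacobian u v (polarPoint r t)) r := by
  have hper : ∀ s, polarPoint s (-Real.pi) = polarPoint s Real.pi := fun s => by
    simp [polarPoint]
  refine (hasDerivAt_integral_mul_deriv (U := fun r t => u (polarPoint r t))
    (V := fun r t => v (polarPoint r t))
    (fun s hs t => hasDerivAt_polarDerivR hu hs t) (fun s hs t => hasDerivAt_polarDerivT hu hs t)
    (fun s hs t => hasDerivAt_polarDerivR hv hs t) (fun s hs t => hasDerivAt_polarDerivT hv hs t)
    (continuousOn_polarDerivR hu) (continuousOn_polarDerivT hu)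
    (continuousOn_polarDerivR hv) (continuousOn_polarDerivT hv)
    (by linarith [Real.pi_pos]) (fun s => by simp only [hper]) (fun s => by simp only [hper])
    hr).congr_deriv ?_
  refine intervalIntegral.integral_congr fun t _ => ?_
  simp only [polarDerivR, polarDerivT, jacobian]
  linear_combination r * (fderiv ℝ u (polarPoint r t) (e2 0) * fderiv ℝ v (polarPoint r t) (e2 1)
    - fderiv ℝ u (polarPoint r t) (e2 1) * fderiv ℝ v (polarPoint r t) (e2 0))
    * Real.sin_sq_add_cos_sq t

/-- Green's formula for `C¹` maps on discs. -/
theorem setIntegral_jacobian_eq_circleArea {u v : E2 → ℝ} (hu : ContDiffOn ℝ 1 u (ball 0 1))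
    (hv : ContDiffOn ℝ 1 v (ball 0 1)) {R : ℝ} (hR0 : 0 ≤ R) (hR1 : R < 1) :
    ∫ x in ball (0 : E2) R, jacobian u v x = circleArea u v R := by
  have hpolar := setIntegral_annulus_eq_polar (continuousOn_jacobian hu hv) le_rfl hR0 hR1
  rw [ball_zero, Set.sdiff_empty] at hpolar
  have hsub : Set.uIcc 0 R ⊆ Set.Ioo (-1 : ℝ) 1 := by
    rw [Set.uIcc_of_le hR0]
    exact fun x hx => ⟨by linarith [hx.1], by linarith [hx.2]⟩
  have hc : ContinuousOn (fun r => ∫ t in -Real.pi..Real.pi, r * jacobian u v (polarPoint r t))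
      (Set.Ioo (-1 : ℝ) 1) :=
    continuousOn_integral_polarPoint (continuousOn_jacobian hu hv)
  rw [hpolar, intervalIntegral.integral_eq_sub_of_hasDerivAt
    (fun r hr => hasDerivAt_circleArea hu hv (hsub hr)) (hc.mono hsub).intervalIntegrable]
  simp [circleArea, polarDerivT]

theorem two_mul_circleArea_le {u v : E2 → ℝ} (hu : ContDiffOn ℝ 1 u (ball 0 1))
    (hv : ContDiffOn ℝ 1 v (ball 0 1)) {r : ℝ} (hr : r ∈ Set.Ioo (-1 : ℝ) 1) :
    2 * circleArea u v r ≤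
      ∫ t in -Real.pi..Real.pi, (polarDerivT u r t ^ 2 + polarDerivT v r t ^ 2) := by
  have hc : ∀ {w : E2 → ℝ}, ContDiffOn ℝ 1 w (ball 0 1) → Continuous (polarDerivT w r) :=
    fun hw => (continuousOn_polarDerivT hw).comp_continuous (f := fun t => (r, t)) (by fun_prop)
      (fun _ => ⟨hr, trivial⟩)
  exact integral_mul_deriv_le_of_periodic (fun t => hasDerivAt_polarDerivT hu hr t) (hc hu)
    ((polarPoint_periodic r).comp u) (fun t => hasDerivAt_polarDerivT hv hr t) (hc hv)
    ((polarPoint_periodic r).comp v)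

theorem contDiffOn_fderiv_apply {f : E2 → ℝ} (hf : ContDiffOn ℝ 2 f (ball 0 1)) (w : E2) :
    ContDiffOn ℝ 1 (fun z => fderiv ℝ f z w) (ball 0 1) :=
  (hf.fderiv_of_isOpen isOpen_ball (by norm_num)).clm_apply contDiffOn_const

theorem hessDet_eq_jacobian (f : E2 → ℝ) :
    hessDet f = jacobian (fun z => fderiv ℝ f z (e2 0)) (fun z => fderiv ℝ f z (e2 1)) := rfl

theorem continuousOn_hessFrobSq {f : E2 → ℝ} (hf : ContDiffOn ℝ 2 f (ball 0 1)) :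
    ContinuousOn (hessFrobSq f) (ball 0 1) :=
  continuousOn_finsetSum _ fun i _ => continuousOn_finsetSum _ fun j _ =>
    (continuousOn_fderiv_apply (contDiffOn_fderiv_apply hf (e2 i)) (e2 j)).pow 2

theorem hessFrobSq_nonneg (f : E2 → ℝ) (x : E2) : 0 ≤ hessFrobSq f x :=
  Finset.sum_nonneg fun _ _ => Finset.sum_nonneg fun _ _ => sq_nonneg _

theorem polarDerivT_sq_le (u : E2 → ℝ) (r t : ℝ) :
    polarDerivT u r t ^ 2 ≤ r ^ 2 * (fderiv ℝ u (polarPoint r t) (e2 0) ^ 2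
      + fderiv ℝ u (polarPoint r t) (e2 1) ^ 2) := by
  rw [polarDerivT, mul_pow]
  refine mul_le_mul_of_nonneg_left ?_ (sq_nonneg r)
  generalize fderiv ℝ u (polarPoint r t) (e2 0) = p
  generalize fderiv ℝ u (polarPoint r t) (e2 1) = q
  have h : (q * Real.cos t - p * Real.sin t) ^ 2 + (q * Real.sin t + p * Real.cos t) ^ 2
      = p ^ 2 + q ^ 2 := by
    linear_combination (p ^ 2 + q ^ 2) * Real.sin_sq_add_cos_sq t
  nlinarith [sq_nonneg (q * Real.sin t + p * Real.cos t)]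

theorem two_mul_setIntegral_hessDet_le {f : E2 → ℝ} (hf : ContDiffOn ℝ 2 f (ball 0 1)) {r : ℝ}
    (hr0 : 0 < r) (hr1 : r < 1) :
    2 * ∫ x in ball (0 : E2) r, hessDet f x ≤
      r * ∫ t in -Real.pi..Real.pi, r * hessFrobSq f (polarPoint r t) := by
  have hpi := Real.pi_pos
  have hr : r ∈ Set.Ioo (-1 : ℝ) 1 := ⟨by linarith, hr1⟩
  have hu := contDiffOn_fderiv_apply hf (e2 0)
  have hv := contDiffOn_fderiv_apply hf (e2 1)
  have hcT : ∀ {w : E2 → ℝ}, ContDiffOn ℝ 1 w (ball 0 1) → Continuous (polarDerivT w r) :=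
    fun hw => (continuousOn_polarDerivT hw).comp_continuous (f := fun t => (r, t)) (by fun_prop)
      (fun _ => ⟨hr, trivial⟩)
  have hcF : Continuous fun t => hessFrobSq f (polarPoint r t) :=
    (continuousOn_comp_polarPoint (continuousOn_hessFrobSq hf)).comp_continuous
      (f := fun t => (r, t)) (by fun_prop) (fun _ => ⟨hr, trivial⟩)
  rw [hessDet_eq_jacobian, setIntegral_jacobian_eq_circleArea hu hv hr0.le hr1,
    ← intervalIntegral.integral_const_mul]
  refine (two_mul_circleArea_le hu hv hr).trans ?_
  refine intervalIntegral.integral_mono_on (by linarith)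
    ((((hcT hu).pow 2).add ((hcT hv).pow 2)).intervalIntegrable _ _)
    (Continuous.intervalIntegrable (by fun_prop) _ _) fun t _ => ?_
  refine (add_le_add (polarDerivT_sq_le _ r t) (polarDerivT_sq_le _ r t)).trans (le_of_eq ?_)
  simp only [hessFrobSq, hess, Fin.sum_univ_two]
  ring

theorem integrableOn_of_continuousOn_ball {g : E2 → ℝ} (hg : ContinuousOn g (ball 0 1)) {s : Set E2}
    {b : ℝ} (hb : b < 1) (hs : s ⊆ ball 0 b) : IntegrableOn g s :=
  ((hg.mono (closedBall_subset_ball hb)).integrableOn_compact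
    (isCompact_closedBall (0 : E2) b)).mono_set (hs.trans ball_subset_closedBall)

theorem kappa3_eq_sum {y : Fin 3 → E2 → ℝ} (hy : ∀ i, ContDiffOn ℝ 2 (y i) (ball (0 : E2) 1))
    {r : ℝ} (hr : r < 1) : kappa3 y r = ∑ i, ∫ x in ball (0 : E2) r, hessDet (y i) x :=
  integral_finsetSum _ fun i _ => integrableOn_of_continuousOn_ball
    (continuousOn_jacobian (contDiffOn_fderiv_apply (hy i) (e2 0))
      (contDiffOn_fderiv_apply (hy i) (e2 1))) hr subset_rfl

theorem continuousOn_kappa3 {y : Fin 3 → E2 → ℝ}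
    (hy : ∀ i, ContDiffOn ℝ 2 (y i) (ball (0 : E2) 1)) :
    ContinuousOn (kappa3 y) (Set.Ioo 0 1) := by
  refine ContinuousOn.congr (f := fun r => ∑ i, circleArea (fun z => fderiv ℝ (y i) z (e2 0))
    (fun z => fderiv ℝ (y i) z (e2 1)) r) ?_ fun r hr => ?_
  · exact continuousOn_finsetSum _ fun i _ r hr => (hasDerivAt_circleArea
      (contDiffOn_fderiv_apply (hy i) (e2 0)) (contDiffOn_fderiv_apply (hy i) (e2 1))
      ⟨by linarith [hr.1], hr.2⟩).continuousAt.continuousWithinAt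
  · rw [kappa3_eq_sum hy hr.2]
    exact Finset.sum_congr rfl fun i _ => setIntegral_jacobian_eq_circleArea
      (contDiffOn_fderiv_apply (hy i) (e2 0)) (contDiffOn_fderiv_apply (hy i) (e2 1)) hr.1.le hr.2

/-- The energy on the annulus dominates the weighted integral of `2 * kappa3 y ρ / ρ`. -/
theorem integral_kappa3_div_le {y : Fin 3 → E2 → ℝ}
    (hy : ∀ i, ContDiffOn ℝ 2 (y i) (ball (0 : E2) 1)) {a r b : ℝ} (ha : 0 < a) (har : a ≤ r)
    (hrb : r ≤ b) (hb : b < 1) :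
    ∫ ρ in r..b, 2 * kappa3 y ρ / ρ ≤
      ∑ i : Fin 3, ∫ x in ball (0 : E2) b \ ball (0 : E2) a, hessFrobSq (y i) x := by
  have hpi := Real.pi_pos
  set Q : Fin 3 → ℝ → ℝ := fun i ρ =>
    ∫ t in -Real.pi..Real.pi, ρ * hessFrobSq (y i) (polarPoint ρ t) with hQ
  have hQc : ∀ i, ContinuousOn (Q i) (Set.Ioo (-1) 1) := fun i =>
    continuousOn_integral_polarPoint (continuousOn_hessFrobSq (hy i))
  have hsub : ∀ {c : ℝ}, 0 < c → c ≤ b → Set.uIcc c b ⊆ Set.Ioo 0 1 := fun {c} hc hcb x hx => by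
    rw [Set.uIcc_of_le hcb] at hx
    exact ⟨hc.trans_le hx.1, hx.2.trans_lt hb⟩
  have hQi : ∀ {c : ℝ}, 0 < c → c ≤ b → ∀ i, IntervalIntegrable (Q i) volume c b :=
    fun hc hcb i => ((hQc i).mono ((hsub hc hcb).trans
      (Set.Ioo_subset_Ioo_left (by norm_num)))).intervalIntegrable
  have hr0 : 0 < r := ha.trans_le har
  calc ∫ ρ in r..b, 2 * kappa3 y ρ / ρ ≤ ∫ ρ in r..b, ∑ i, Q i ρ := by
        refine intervalIntegral.integral_mono_on hrb ?_
          (by rw [← Finset.sum_fn]; exact IntervalIntegrable.sum _ fun i _ => hQi hr0 hrb i)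
          fun ρ hρ => ?_
        · refine ContinuousOn.intervalIntegrable ?_
          have := (continuousOn_kappa3 hy).mono (hsub hr0 hrb)
          exact (continuousOn_const.mul this).div continuousOn_id
            fun x hx => (hsub hr0 hrb hx).1.ne'
        · have hρ0 : 0 < ρ := hr0.trans_le hρ.1
          have hρ1 : ρ < 1 := hρ.2.trans_lt hb
          rw [div_le_iff₀ hρ0, kappa3_eq_sum hy hρ1, Finset.mul_sum, mul_comm, Finset.mul_sum]
          exact Finset.sum_le_sum fun i _ => two_mul_setIntegral_hessDet_le (hy i) hρ0 hρ1
    _ = ∑ i, ∫ ρ in r..b, Q i ρ := intervalIntegral.integral_finsetSum fun i _ => hQi hr0 hrb i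
    _ ≤ ∑ i, ∫ ρ in a..b, Q i ρ := by
        refine Finset.sum_le_sum fun i _ => ?_
        refine intervalIntegral.integral_mono_interval har hrb le_rfl ?_ (hQi ha (har.trans hrb) i)
        refine (ae_restrict_iff' measurableSet_Ioc).2 (Filter.Eventually.of_forall fun ρ hρ => ?_)
        exact intervalIntegral.integral_nonneg (by linarith) fun t _ =>
          mul_nonneg (ha.trans hρ.1).le (hessFrobSq_nonneg _ _)
    _ = _ := by
        refine Finset.sum_congr rfl fun i _ => ?_
        exact (setIntegral_annulus_eq_polar (continuousOn_hessFrobSq (hy i)) ha.le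
          (har.trans hrb) hb).symm

/-- Integration by parts against `1 / ρ`, for a nonnegative density whose primitive is at most
`K * √R`. -/
theorem integral_div_le_of_primitive_le_sqrt {g : ℝ → ℝ} {a r b K : ℝ}
    (hg : ContinuousOn g (Set.Ioo 0 1)) (hg0 : ∀ x, 0 ≤ g x) (hK : 0 ≤ K) (ha : 0 < a)
    (har : a ≤ r) (hrb : r ≤ b) (hb : b < 1)
    (hE : ∀ R, a ≤ R → R ≤ b → ∫ x in a..R, g x ≤ K * Real.sqrt R) :
    ∫ x in r..b, g x / x ≤ 2 * K / Real.sqrt r := by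
  have hr0 : 0 < r := ha.trans_le har
  have hb0 : 0 < b := hr0.trans_le hrb
  have hmem : ∀ x ∈ Set.uIcc r b, r ≤ x ∧ x ≤ b := fun x hx => by
    rwa [Set.uIcc_of_le hrb] at hx
  have hpos : ∀ x ∈ Set.uIcc r b, 0 < x := fun x hx => hr0.trans_le (hmem x hx).1
  have hsub : Set.uIcc r b ⊆ Set.Ioo 0 1 := fun x hx => ⟨hpos x hx, (hmem x hx).2.trans_lt hb⟩
  set E : ℝ → ℝ := fun R => ∫ x in a..R, g x with hEdef
  have hEd : ∀ x ∈ Set.uIcc r b, HasDerivAt E (g x) x := by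
    intro x hx
    refine intervalIntegral.integral_hasDerivAt_right ?_
      (hg.stronglyMeasurableAtFilter isOpen_Ioo x (hsub hx))
      (hg.continuousAt (isOpen_Ioo.mem_nhds (hsub hx)))
    refine (hg.mono fun z hz => ?_).intervalIntegrable
    rw [Set.uIcc_of_le (har.trans (hmem x hx).1)] at hz
    exact ⟨ha.trans_le hz.1, (hz.2.trans (hmem x hx).2).trans_lt hb⟩
  have hEc : ContinuousOn E (Set.uIcc r b) := fun x hx =>
    (hEd x hx).continuousAt.continuousWithinAt
  have hgc := hg.mono hsub
  have hd : ∀ x ∈ Set.uIcc r b, HasDerivAt (fun x => E x / x - 2 * K * (Real.sqrt x)⁻¹)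
      (g x / x - E x / x ^ 2 + K / (Real.sqrt x * x)) x := by
    intro x hx
    have hx0 := hpos x hx
    have hs0 : 0 < Real.sqrt x := Real.sqrt_pos.2 hx0
    have h1 := (hEd x hx).div (hasDerivAt_id x) hx0.ne'
    have h2 := ((Real.hasDerivAt_sqrt hx0.ne').inv hs0.ne').const_mul (2 * K)
    refine (h1.sub h2).congr_deriv ?_
    rw [Real.sq_sqrt hx0.le]
    simp only [id]
    field_simp
    ring
  have hne : ∀ x ∈ Set.uIcc r b, x ≠ 0 := fun x hx => (hpos x hx).ne'
  have hquot : ContinuousOn (fun x => g x / x) (Set.uIcc r b) := hgc.div continuousOn_id hne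
  have hder : ContinuousOn (fun x => g x / x - E x / x ^ 2 + K / (Real.sqrt x * x))
      (Set.uIcc r b) := by
    refine (hquot.sub (hEc.div (by fun_prop) fun x hx => pow_ne_zero 2 (hne x hx))).add
      (continuousOn_const.div (by fun_prop) fun x hx => ?_)
    exact mul_ne_zero (Real.sqrt_pos.2 (hpos x hx)).ne' (hne x hx)
  have hle : ∫ x in r..b, g x / x ≤
      ∫ x in r..b, (g x / x - E x / x ^ 2 + K / (Real.sqrt x * x)) := by
    refine intervalIntegral.integral_mono_on hrb hquot.intervalIntegrable hder.intervalIntegrable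
      fun x hx => ?_
    have hx0 : 0 < x := hr0.trans_le hx.1
    have hs0 : 0 < Real.sqrt x := Real.sqrt_pos.2 hx0
    have h1 : E x / x ^ 2 ≤ K / (Real.sqrt x * x) := by
      rw [div_le_div_iff₀ (by positivity) (by positivity)]
      calc E x * (Real.sqrt x * x) ≤ K * Real.sqrt x * (Real.sqrt x * x) :=
            mul_le_mul_of_nonneg_right (hE x (har.trans hx.1) hx.2) (by positivity)
        _ = K * (Real.sqrt x * Real.sqrt x) * x := by ring
        _ = K * x ^ 2 := by rw [Real.mul_self_sqrt hx0.le]; ring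
    linarith
  rw [intervalIntegral.integral_eq_sub_of_hasDerivAt hd hder.intervalIntegrable] at hle
  have hEr : 0 ≤ E r / r :=
    div_nonneg (intervalIntegral.integral_nonneg har fun x _ => hg0 x) hr0.le
  have hEb : E b / b ≤ K * (Real.sqrt b)⁻¹ := by
    rw [div_le_iff₀ hb0]
    refine (hE b (har.trans hrb) le_rfl).trans (le_of_eq ?_)
    have hs0 : 0 < Real.sqrt b := Real.sqrt_pos.2 hb0
    field_simp
    rw [Real.sq_sqrt hb0.le]
  have hKb : 0 ≤ K * (Real.sqrt b)⁻¹ := by positivity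
  rw [div_eq_mul_inv (2 * K)]
  linarith

/-- The smallness conditions on `h` needed in the main estimate. -/
theorem exists_small_of_log_rpow {α : ℝ} (hα : 0 < α) :
    ∃ h₀ : ℝ, 0 < h₀ ∧ ∀ h : ℝ, 0 < h → h < h₀ → h ≤ 1 / 10 ∧
      6 ≤ |Real.log h| ^ (2 * α) ∧ h * |Real.log h| ^ (2 * α) ≤ 1 / 2 := by
  have h1 : ∀ᶠ h : ℝ in nhdsWithin 0 (Set.Ioi 0), h ≤ 1 / 10 := by
    filter_upwards [Ioo_mem_nhdsGT (show (0 : ℝ) < 1 / 10 by norm_num)] with h hh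
    exact hh.2.le
  have h2 : ∀ᶠ h : ℝ in nhdsWithin 0 (Set.Ioi 0), 6 ≤ |Real.log h| ^ (2 * α) :=
    ((tendsto_rpow_atTop (by positivity : 0 < 2 * α)).comp
      (Filter.tendsto_abs_atBot_atTop.comp Real.tendsto_log_nhdsGT_zero)).eventually_ge_atTop 6
  have h3 : ∀ᶠ h : ℝ in nhdsWithin 0 (Set.Ioi 0), h * |Real.log h| ^ (2 * α) ≤ 1 / 2 := by
    filter_upwards [(isLittleO_abs_log_rpow_rpow_nhdsGT_zero (2 * α)
      (by norm_num : (-1 : ℝ) < 0)).bound (show (0 : ℝ) < 1 / 2 by norm_num),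
      self_mem_nhdsWithin] with h hb hh
    have hh0 : 0 < h := hh
    rw [Real.rpow_neg_one, Real.norm_of_nonneg (by positivity),
      Real.norm_of_nonneg (by positivity), ← div_eq_mul_inv, le_div_iff₀ hh0] at hb
    linarith
  obtain ⟨h₀, hh₀, hs⟩ := (mem_nhdsGT_iff_exists_Ioo_subset).1 ((h1.and (h2.and h3)))
  exact ⟨h₀, hh₀, fun h hp hl => hs ⟨hp, hl⟩⟩

/-- If `y_i ∈ C²(B₁)`, `α > 0` and
`‖κ_y − πΔ²‖_{L¹(6h,R)} ≤ C h^{1/2} R^{1/2} |log h|^α` for all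
`R ∈ [6h, 1−5h]`, then
`Σᵢ ∫_{B_{1−5h}∖B_{5h}} |D²yᵢ|² ≥ 2πΔ²(|log h| − 2α log|log h| − C')`
with `C' = C'(Δ, C, α)`, for all small enough `h`. -/
theorem stmt10 (Δ : ℝ) (hΔ : Δ ∈ Set.Ioo (0 : ℝ) 1) (α : ℝ) (hα : 0 < α)
    (C : ℝ) (hC : 0 < C) :
    ∃ C' : ℝ, 0 < C' ∧ ∃ h₀ : ℝ, 0 < h₀ ∧ ∀ h : ℝ, 0 < h → h < h₀ →
      ∀ y : Fin 3 → E2 → ℝ, (∀ i, ContDiffOn ℝ 2 (y i) (ball (0 : E2) 1)) →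
        (∀ R : ℝ, 6 * h ≤ R → R ≤ 1 - 5 * h →
          (∫ ρ in Set.Ioc (6 * h) R, |kappa3 y ρ - Real.pi * Δ ^ 2|)
            ≤ C * Real.sqrt h * Real.sqrt R * |Real.log h| ^ α) →
        2 * Real.pi * Δ ^ 2 *
            (|Real.log h| - 2 * α * Real.log |Real.log h| - C')
          ≤ ∑ i : Fin 3, ∫ x in ball (0 : E2) (1 - 5 * h) \ ball (0 : E2) (5 * h),
              hessFrobSq (y i) x := by
  have hpi := Real.pi_pos
  have hΔ0 : 0 < Δ := hΔ.1
  obtain ⟨h₀, hh₀, hsmall⟩ := exists_small_of_log_rpow hα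
  have hA : 0 < 2 * Real.pi * Δ ^ 2 := by positivity
  refine ⟨1 + 4 * C / (2 * Real.pi * Δ ^ 2), by positivity, h₀, hh₀, fun h hh hlt y hy hL => ?_⟩
  obtain ⟨hh10, hL6, hL2⟩ := hsmall h hh hlt
  set L := |Real.log h| with hLdef
  have hlog : Real.log h = -L := by
    rw [hLdef, abs_of_nonpos (Real.log_nonpos hh.le (by linarith)), neg_neg]
  have hL0 : 0 < L := by
    refine lt_of_le_of_ne (abs_nonneg _) fun h0 => ?_
    rw [← h0, Real.zero_rpow (by positivity)] at hL6
    norm_num at hL6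
  set r := h * L ^ (2 * α) with hr
  set b := 1 - 5 * h with hb
  have hb1 : b < 1 := by linarith
  have har : 6 * h ≤ r := by rw [hr, mul_comm]; exact mul_le_mul_of_nonneg_left hL6 hh.le
  have hrb : r ≤ b := by linarith
  have hr0 : 0 < r := by linarith
  have hb0 : 0 < b := by linarith
  have hsqrt : Real.sqrt r = Real.sqrt h * L ^ α := by
    rw [hr, Real.sqrt_mul hh.le, mul_comm 2 α, Real.rpow_mul hL0.le, Real.rpow_two,
      Real.sqrt_sq (by positivity)]
  have hκ := continuousOn_kappa3 hy
  have hsub : Set.uIcc r b ⊆ Set.Ioo 0 1 := fun x hx => by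
    rw [Set.uIcc_of_le hrb] at hx
    exact ⟨hr0.trans_le hx.1, hx.2.trans_lt hb1⟩
  have hne : ∀ x ∈ Set.uIcc r b, x ≠ 0 := fun x hx => (hsub hx).1.ne'
  have hg : ContinuousOn (fun ρ => |kappa3 y ρ - Real.pi * Δ ^ 2|) (Set.Ioo 0 1) :=
    (hκ.sub continuousOn_const).abs
  have herr : ∫ ρ in r..b, |kappa3 y ρ - Real.pi * Δ ^ 2| / ρ ≤ 2 * C := by
    have h1 := integral_div_le_of_primitive_le_sqrt (K := C * Real.sqrt h * L ^ α) hg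
      (fun _ => abs_nonneg _) (by positivity) (by linarith : 0 < 6 * h) har hrb hb1
      (fun R h1 h2 => by
        rw [intervalIntegral.integral_of_le h1]
        exact (hL R h1 h2).trans (le_of_eq (by ring)))
    refine h1.trans (le_of_eq ?_)
    have : 0 < Real.sqrt h := Real.sqrt_pos.2 hh
    rw [hsqrt]
    field_simp
  have hi1 : IntervalIntegrable (fun ρ : ℝ => 2 * Real.pi * Δ ^ 2 * ρ⁻¹) volume r b :=
    (continuousOn_const.mul (continuousOn_id.inv₀ hne)).intervalIntegrable
  have hi2 : IntervalIntegrable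
      (fun ρ : ℝ => 2 * (|kappa3 y ρ - Real.pi * Δ ^ 2| / ρ)) volume r b :=
    (continuousOn_const.mul ((hg.mono hsub).div continuousOn_id hne)).intervalIntegrable
  have hi3 : IntervalIntegrable (fun ρ : ℝ => 2 * kappa3 y ρ / ρ) volume r b :=
    ((continuousOn_const.mul (hκ.mono hsub)).div continuousOn_id hne).intervalIntegrable
  have hmain : ∫ ρ in r..b, (2 * Real.pi * Δ ^ 2 * ρ⁻¹
      - 2 * (|kappa3 y ρ - Real.pi * Δ ^ 2| / ρ)) ≤ ∫ ρ in r..b, 2 * kappa3 y ρ / ρ := by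
    refine intervalIntegral.integral_mono_on hrb (hi1.sub hi2) hi3 fun ρ hρ => ?_
    have hρ0 : 0 < ρ := hr0.trans_le hρ.1
    have h1 := neg_abs_le (kappa3 y ρ - Real.pi * Δ ^ 2)
    rw [← div_eq_mul_inv, ← mul_div_assoc, ← sub_div]
    exact div_le_div_of_nonneg_right (by linarith) hρ0.le
  rw [intervalIntegral.integral_sub hi1 hi2, intervalIntegral.integral_const_mul,
    intervalIntegral.integral_const_mul, integral_inv_of_pos hr0 hb0,
    Real.log_div hb0.ne' hr0.ne', hr, Real.log_mul hh.ne' (by positivity), Real.log_rpow hL0,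
    hlog, ← hr] at hmain
  have henergy := integral_kappa3_div_le hy (by linarith : 0 < 5 * h) (by linarith) hrb hb1
  have hlogb : -1 ≤ Real.log b := by
    have h1 := Real.one_sub_inv_le_log_of_pos hb0
    have h2 : b⁻¹ ≤ 2 := by
      rw [inv_le_comm₀ hb0 (by norm_num)]
      linarith
    linarith
  refine le_trans ?_ henergy
  refine le_trans ?_ hmain
  have h1 : 2 * Real.pi * Δ ^ 2 * (4 * C / (2 * Real.pi * Δ ^ 2)) = 4 * C := by
    field_simp
  have h2 : 2 * Real.pi * Δ ^ 2 * (-1) ≤ 2 * Real.pi * Δ ^ 2 * Real.log b :=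
    mul_le_mul_of_nonneg_left hlogb hA.le
  linarith
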